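/- arXiv:1301.1797 — 2 statements merged into one kernel-verified Lean document; each statement's English description precedes it below -/
import Mathlib

section
/- Let γ: (0,∞)→(0,∞) be continuous, φ: (0,∞)→[0,∞) measurable with φ/γ locally integrable on (0,∞), let Q(x) = ∫_x^{x̄} φ(y)/γ(y) dy for a fixed x̄ (with Q finite on (0,∞)) and suppose ∫₀^δ φ(x)/γ(x) dx = +∞ for some δ>0 (so that e^{Q(y)} ∫₀^y (φ(z)/γ(z)) e^{−Q(z)} dz = 1 for all y>0). Let h: (0,∞)×(0,∞)→[0,∞) be measurable with ∫₀^∞ h(x,y)dx = 1 for every y, let m₁(z) = ∫₀^∞ x h(x,z) dx be finite for every z, and let k(x,y) = e^{Q(y)} ∫₀^y 1_{(0,x)}(z) h(x−z,z)(φ(z)/γ(z)) e^{−Q(z)} dz. Then for every y>0, ∫₀^∞ x·k(x,y) dx − y = e^{Q(y)} ∫₀^y (m₁(z)·φ(z)/γ(z) − 1) e^{−Q(z)} dz. -/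
open MeasureTheory

lemma aux_ac_exp {P : ℝ → ℝ} {a b : ℝ} (hP : AbsolutelyContinuousOnInterval P a b) :
    AbsolutelyContinuousOnInterval (fun x => Real.exp (P x)) a b := by
  obtain ⟨M, hM⟩ := hP.exists_bound
  have hL : ∀ x ∈ Set.uIcc a b, ∀ z ∈ Set.uIcc a b,
      dist (Real.exp (P x)) (Real.exp (P z)) ≤ Real.exp M * dist (P x) (P z) := by
    intro x hx z hz
    have h1 : ∀ t ∈ Set.Iic M, HasDerivWithinAt Real.exp (Real.exp t) (Set.Iic M) t :=
      fun t _ => (Real.hasDerivAt_exp t).hasDerivWithinAt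
    have h2 := (convex_Iic M).norm_image_sub_le_of_norm_hasDerivWithin_le (C := Real.exp M) h1
      (fun t ht => by
        rw [Real.norm_of_nonneg (Real.exp_pos _).le]
        exact Real.exp_le_exp.2 ht)
      (show P z ∈ Set.Iic M from (le_abs_self _).trans (hM z hz))
      (show P x ∈ Set.Iic M from (le_abs_self _).trans (hM x hx))
    simpa [Real.dist_eq, Real.norm_eq_abs] using h2
  rw [absolutelyContinuousOnInterval_iff] at hP ⊢
  intro ε hε
  obtain ⟨δ, hδ, h⟩ := hP (ε / Real.exp M) (by positivity)
  refine ⟨δ, hδ, fun E hE hEδ => ?_⟩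
  have h3 := h E hE hEδ
  rw [lt_div_iff₀ (Real.exp_pos M)] at h3
  refine lt_of_le_of_lt ?_ h3
  rw [Finset.sum_mul]
  refine Finset.sum_le_sum fun i hi => ?_
  have h4 := hE.1 i (by simpa using hi)
  rw [mul_comm]
  exact hL _ h4.1 _ h4.2

lemma aux_key {g : ℝ → ℝ} {a b C : ℝ} (hg : IntervalIntegrable g volume a b) :
    IntervalIntegrable (fun x => Real.exp (C + ∫ t in a..x, g t)) volume a b ∧
    IntervalIntegrable (fun x => x * (g x * Real.exp (C + ∫ t in a..x, g t))) volume a b ∧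
    (∫ x in a..b, (Real.exp (C + ∫ t in a..x, g t)
        + x * (g x * Real.exp (C + ∫ t in a..x, g t))))
      = b * Real.exp (C + ∫ t in a..b, g t) - a * Real.exp C := by
  have hP0 := hg.absolutelyContinuousOnInterval_intervalIntegral (c := a) (by simp)
  have hconst : AbsolutelyContinuousOnInterval (fun _ : ℝ => C) a b :=
    (LipschitzWith.const C).lipschitzOnWith.absolutelyContinuousOnInterval
  have hid : AbsolutelyContinuousOnInterval (fun x : ℝ => x) a b :=
    LipschitzWith.id.lipschitzOnWith.absolutelyContinuousOnInterval
  have hw := aux_ac_exp (hconst.add hP0)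
  have hw' : AbsolutelyContinuousOnInterval
    (fun x => Real.exp (C + ∫ t in a..x, g t)) a b := hw
  refine ⟨hw'.continuousOn.intervalIntegrable,
    (hg.mul_continuousOn hw'.continuousOn).continuousOn_mul continuousOn_id, ?_⟩
  have h1 := (hid.fun_mul hw').integral_deriv_eq_sub
  simp only [intervalIntegral.integral_same, add_zero] at h1
  rw [← h1]
  apply intervalIntegral.integral_congr_ae
  filter_upwards [hg.ae_hasDerivAt_integral] with x hx hxm
  have h2 := (hx (Set.uIoc_subset_uIcc hxm) a (by simp)).const_add C
  have h3 := ((hasDerivAt_id' x).mul h2.exp).deriv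
  symm
  convert! h3 using 1
  ring

lemma aux_byparts {g Q : ℝ → ℝ} {y : ℝ} (hy : 0 < y)
    (hgi : ∀ a b, 0 < a → 0 < b → IntervalIntegrable g volume a b)
    (hg0 : ∀ x, 0 < x → 0 ≤ g x)
    (hQ : ∀ a b, 0 < a → 0 < b → -Q b = -Q a + ∫ t in a..b, g t) :
    IntegrableOn (fun x => Real.exp (-Q x)) (Set.Ioc 0 y) ∧
    IntegrableOn (fun x => x * (g x * Real.exp (-Q x))) (Set.Ioc 0 y) ∧
    (∫ x in Set.Ioc 0 y, Real.exp (-Q x)) + ∫ x in Set.Ioc 0 y, x * (g x * Real.exp (-Q x))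
      = y * Real.exp (-Q y) := by
  have key : ∀ e, 0 < e → e ≤ y →
    IntegrableOn (fun x => Real.exp (-Q x)) (Set.Ioc e y) ∧
    IntegrableOn (fun x => x * (g x * Real.exp (-Q x))) (Set.Ioc e y) ∧
    (∫ x in Set.Ioc e y, (Real.exp (-Q x) + x * (g x * Real.exp (-Q x))))
      = y * Real.exp (-Q y) - e * Real.exp (-Q e) := by
    intro e he hey
    obtain ⟨h1, h2, h3⟩ := aux_key (C := -Q e) (hgi e y he hy)
    rw [intervalIntegrable_iff_integrableOn_Ioc_of_le hey] at h1 h2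
    rw [intervalIntegral.integral_of_le hey, ← hQ e y he hy] at h3
    refine ⟨h1.congr_fun ?_ measurableSet_Ioc, h2.congr_fun ?_ measurableSet_Ioc, ?_⟩
    · intro x hx
      simp only [← hQ e x he (he.trans hx.1)]
    · intro x hx
      simp only [← hQ e x he (he.trans hx.1)]
    · rw [← h3]
      refine setIntegral_congr_fun measurableSet_Ioc ?_
      intro x hx
      simp only [← hQ e x he (he.trans hx.1)]
  have hmono : ∀ e, 0 < e → e ≤ y → Real.exp (-Q e) ≤ Real.exp (-Q y) := by
    intro e he hey
    apply Real.exp_le_exp.2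
    rw [hQ e y he hy]
    have : 0 ≤ ∫ t in e..y, g t :=
      intervalIntegral.integral_nonneg hey fun u hu => hg0 u (he.trans_le hu.1)
    linarith
  let a : ℕ → ℝ := fun n => y * (1 / ((n : ℝ) + 1))
  have ha0 : ∀ n, 0 < a n := fun n => by positivity
  have hay : ∀ n, a n ≤ y := fun n => by
    have : 1 / ((n : ℝ) + 1) ≤ 1 := by
      rw [div_le_one (by positivity)]; linarith [Nat.cast_nonneg (α := ℝ) n]
    nlinarith
  have hat : Filter.Tendsto a Filter.atTop (nhds 0) := by
    simpa [a] using (tendsto_one_div_add_atTop_nhds_zero_nat (𝕜 := ℝ)).const_mul y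
  have hF : IntegrableOn (fun x => Real.exp (-Q x) + x * (g x * Real.exp (-Q x)))
      (Set.Ioc 0 y) := by
    refine integrableOn_Ioc_of_intervalIntegral_norm_bounded_left
      (I := y * Real.exp (-Q y)) (a := a) (l := Filter.atTop)
      (fun n => (key _ (ha0 n) (hay n)).1.add (key _ (ha0 n) (hay n)).2.1) hat
      (Filter.Eventually.of_forall fun n => ?_)
    have : (∫ x in Set.Ioc (a n) y, ‖Real.exp (-Q x) + x * (g x * Real.exp (-Q x))‖)
        = ∫ x in Set.Ioc (a n) y, (Real.exp (-Q x) + x * (g x * Real.exp (-Q x))) := by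
      refine setIntegral_congr_fun measurableSet_Ioc fun x hx => ?_
      have hx0 : 0 < x := (ha0 n).trans hx.1
      have := hg0 x hx0
      exact Real.norm_of_nonneg (by positivity)
    rw [this, (key _ (ha0 n) (hay n)).2.2]
    have := mul_pos (ha0 n) (Real.exp_pos (-Q (a n)))
    linarith
  have hcontQ : AEStronglyMeasurable (fun x => Real.exp (-Q x)) 
      (volume.restrict (Set.Ioc 0 y)) := by
    have h5 : MonotoneOn (fun x => Real.exp (-Q x)) (Set.Ioc 0 y) := by
      intro u hu v hv huv
      apply Real.exp_le_exp.2
      rw [hQ u v hu.1 hv.1]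
      have : 0 ≤ ∫ t in u..v, g t :=
        intervalIntegral.integral_nonneg huv fun s hs => hg0 s (hu.1.trans_le hs.1)
      linarith
    exact (aemeasurable_restrict_of_monotoneOn measurableSet_Ioc h5).aestronglyMeasurable
  have hw : IntegrableOn (fun x => Real.exp (-Q x)) (Set.Ioc 0 y) := by
    refine Integrable.mono' hF hcontQ ?_
    filter_upwards [ae_restrict_mem measurableSet_Ioc] with x hx
    have := hg0 x hx.1
    have hx0 := hx.1
    rw [Real.norm_of_nonneg (Real.exp_pos _).le]
    have : 0 ≤ x * (g x * Real.exp (-Q x)) := by positivity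
    linarith
  have hG : IntegrableOn (fun x => x * (g x * Real.exp (-Q x))) (Set.Ioc 0 y) := by
    have := hF.sub hw
    refine this.congr (Filter.Eventually.of_forall fun x => ?_)
    simp
  refine ⟨hw, hG, ?_⟩
  rw [← integral_add hw hG]
  have hlim := (aecover_Ioc_of_Ioc (μ := volume) hat
    (tendsto_const_nhds (x := y) (f := Filter.atTop))).integral_tendsto_of_countably_generated hF
  refine tendsto_nhds_unique hlim ?_
  have heq : ∀ n, (∫ x in Set.Ioc (a n) y, (Real.exp (-Q x) + x * (g x * Real.exp (-Q x)))
      ∂(volume.restrict (Set.Ioc 0 y)))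
      = y * Real.exp (-Q y) - a n * Real.exp (-Q (a n)) := by
    intro n
    rw [← (key _ (ha0 n) (hay n)).2.2, Measure.restrict_restrict measurableSet_Ioc,
      Set.inter_eq_self_of_subset_left (Set.Ioc_subset_Ioc_left (ha0 n).le)]
  simp only [heq]
  have h0 : Filter.Tendsto (fun n => a n * Real.exp (-Q (a n))) Filter.atTop (nhds 0) := by
    refine squeeze_zero (fun n => (mul_pos (ha0 n) (Real.exp_pos _)).le)
      (fun n => mul_le_mul_of_nonneg_left (hmono _ (ha0 n) (hay n)) (ha0 n).le) ?_
    simpa using hat.mul_const (Real.exp (-Q y))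
  simpa using h0.const_sub (y * Real.exp (-Q y))

lemma aux_shift {f : ℝ → ℝ} {z : ℝ} (hz : 0 < z) 
    (h0 : IntegrableOn f (Set.Ioi 0)) (h1 : IntegrableOn (fun x => x * f x) (Set.Ioi 0)) (G : ℝ) :
    IntegrableOn (fun x => x * (if z < x then f (x - z) * G else 0)) (Set.Ioi 0) ∧
    ∫ x in Set.Ioi 0, x * (if z < x then f (x - z) * G else 0)
      = ((∫ x in Set.Ioi 0, x * f x) + z * ∫ x in Set.Ioi 0, f x) * G := by
  let F : ℝ → ℝ := (Set.Ioi (0:ℝ)).indicator (fun u => (u * f u + z * f u) * G)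
  have hF : Integrable F := 
    (integrable_indicator_iff measurableSet_Ioi).2 ((h1.add (h0.const_mul z)).mul_const G)
  have hE : (Set.Ioi (0:ℝ)).indicator (fun x => x * (if z < x then f (x - z) * G else 0))
      = fun x => F (x - z) := by
    ext x
    simp only [F, Set.indicator, Set.mem_Ioi, sub_pos]
    by_cases hx : z < x
    · simp only [hx, hz.trans hx, if_true]; ring
    · simp [hx]
  constructor
  · rw [← integrable_indicator_iff measurableSet_Ioi, hE]
    exact hF.comp_sub_right z
  · rw [← integral_indicator measurableSet_Ioi, hE, integral_sub_right_eq_self F z]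
    simp only [F]
    rw [integral_indicator measurableSet_Ioi, integral_mul_const,
      integral_add h1 (h0.const_mul z), integral_const_mul]

theorem stmt13 (γ φ Q : ℝ → ℝ) (xbar : ℝ) (h : ℝ → ℝ → ℝ)
    (m1 : ℝ → ℝ) (k : ℝ → ℝ → ℝ)
    (hγc : ContinuousOn γ (Set.Ioi 0)) (hγpos : ∀ x, 0 < x → 0 < γ x)
    (hφm : Measurable φ) (hφ : ∀ x, 0 < x → 0 ≤ φ x)
    (hloc : LocallyIntegrableOn (fun y => φ y / γ y) (Set.Ioi 0))
    (hxbar : 0 < xbar)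
    (hQint : ∀ x, 0 < x → IntervalIntegrable (fun y => φ y / γ y) volume x xbar)
    (hQ : ∀ x, 0 < x → Q x = ∫ y in x..xbar, φ y / γ y)
    (hdiv : ∃ δ : ℝ, 0 < δ ∧
      (∫⁻ x in Set.Ioc (0 : ℝ) δ, ENNReal.ofReal (φ x / γ x)) = ⊤)
    (hhm : Measurable (Function.uncurry h))
    (hh : ∀ x y, 0 < x → 0 < y → 0 ≤ h x y)
    (hh1 : ∀ y, 0 < y → (∫ x in Set.Ioi (0 : ℝ), h x y) = 1)
    (hm1int : ∀ z, 0 < z → IntegrableOn (fun x => x * h x z) (Set.Ioi 0))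
    (hm1 : ∀ z, 0 < z → m1 z = ∫ x in Set.Ioi (0 : ℝ), x * h x z)
    (hk : ∀ x y, 0 < x → 0 < y → k x y = Real.exp (Q y)
      * ∫ z in Set.Ioc (0 : ℝ) y,
          (if z < x then h (x - z) z * (φ z / γ z) * Real.exp (-(Q z)) else 0))
    (hdriftint : ∀ y, 0 < y →
      IntegrableOn (fun z => m1 z * (φ z / γ z) * Real.exp (-(Q z))) (Set.Ioc 0 y)) :
    ∀ y, 0 < y →
      (∫ x in Set.Ioi (0 : ℝ), x * k x y) - y
        = Real.exp (Q y)
          * ∫ z in Set.Ioc (0 : ℝ) y, (m1 z * (φ z / γ z) - 1) * Real.exp (-(Q z)) := by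
  intro y hy
  have hgi : ∀ a b, 0 < a → 0 < b → IntervalIntegrable (fun y => φ y / γ y) volume a b :=
    fun a b ha hb => (hQint a ha).trans (hQint b hb).symm
  have hg0 : ∀ x, 0 < x → 0 ≤ (fun y => φ y / γ y) x :=
    fun x hx => div_nonneg (hφ x hx) (hγpos x hx).le
  have hQ' : ∀ a b, 0 < a → 0 < b → -Q b = -Q a + ∫ t in a..b, (fun y => φ y / γ y) t := by
    intro a b ha hb
    rw [hQ a ha, hQ b hb, ← intervalIntegral.integral_add_adjacent_intervals (hgi a b ha hb)
      (hgi b xbar hb hxbar)]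
    ring
  obtain ⟨hw, hG, hsum⟩ := aux_byparts hy hgi hg0 hQ'
  have hd := hdriftint y hy
  have hwm := hw.aestronglyMeasurable
  have hgm : AEStronglyMeasurable (fun y => φ y / γ y) (volume.restrict (Set.Ioc 0 y)) :=
    (hloc.aestronglyMeasurable).mono_measure (Measure.restrict_mono Set.Ioc_subset_Ioi_self le_rfl)
  have hsh := fun z (hz : 0 < z) => aux_shift (f := fun x => h x z) hz
    (integrable_of_integral_eq_one (hh1 z hz)) (hm1int z hz) (φ z / γ z * Real.exp (-Q z))
  let F : ℝ → ℝ → ℝ := fun x z =>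
    x * (if z < x then h (x - z) z * (φ z / γ z * Real.exp (-Q z)) else 0)
  have hFm : AEStronglyMeasurable (Function.uncurry F)
      ((volume.restrict (Set.Ioi 0)).prod (volume.restrict (Set.Ioc 0 y))) := by
    have h1 : Measurable (fun p : ℝ × ℝ => if p.2 < p.1 then p.1 * h (p.1 - p.2) p.2 else 0) := by
      refine Measurable.ite (measurableSet_lt measurable_snd measurable_fst) ?_ measurable_const
      exact measurable_fst.mul
        (hhm.comp ((measurable_fst.sub measurable_snd).prodMk measurable_snd))
    have h2 := (hgm.mul hwm).comp_snd (μ := volume.restrict (Set.Ioi (0 : ℝ)))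
    refine (h1.aestronglyMeasurable.mul h2).congr (Filter.Eventually.of_forall fun p => ?_)
    simp only [F, Function.uncurry, Pi.mul_apply]
    split_ifs <;> ring
  have hsum2 : IntegrableOn (fun z => m1 z * (φ z / γ z) * Real.exp (-(Q z))
      + z * (φ z / γ z * Real.exp (-Q z))) (Set.Ioc 0 y) := hd.add hG
  have hin : ∀ z, 0 < z → ∫ x in Set.Ioi 0, F x z = m1 z * (φ z / γ z) * Real.exp (-(Q z))
      + z * (φ z / γ z * Real.exp (-Q z)) := by
    intro z hz
    simp only [F]
    rw [(hsh z hz).2, hh1 z hz, hm1 z hz]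
    ring
  have hFi : Integrable (Function.uncurry F)
      ((volume.restrict (Set.Ioi 0)).prod (volume.restrict (Set.Ioc 0 y))) := by
    rw [integrable_prod_iff' hFm]
    constructor
    · filter_upwards [ae_restrict_mem measurableSet_Ioc] with z hz
      exact (hsh z hz.1).1
    · refine hsum2.congr ?_
      filter_upwards [ae_restrict_mem measurableSet_Ioc] with z hz
      rw [← hin z hz.1]
      refine setIntegral_congr_fun measurableSet_Ioi fun x hx => ?_
      have hx0 : 0 < x := hx
      symm
      refine Real.norm_of_nonneg ?_
      simp only [Function.uncurry, F]
      split_ifs with hzx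
      · have := hh (x - z) z (sub_pos.2 hzx) hz.1
        have h2 : 0 ≤ φ z / γ z := hg0 z hz.1
        positivity
      · simp
  have hkx : ∫ x in Set.Ioi (0 : ℝ), x * k x y
      = Real.exp (Q y) * ∫ x in Set.Ioi (0 : ℝ), ∫ z in Set.Ioc (0 : ℝ) y, F x z := by
    rw [← integral_const_mul]
    refine setIntegral_congr_fun measurableSet_Ioi fun x hx => ?_
    simp only [F]
    rw [hk x y hx hy, integral_const_mul]
    simp only [mul_assoc]
    ring
  rw [hkx, integral_integral_swap hFi,
    setIntegral_congr_fun measurableSet_Ioc fun z hz => hin z hz.1, integral_add hd hG]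
  have hR : ∫ z in Set.Ioc (0 : ℝ) y, (m1 z * (φ z / γ z) - 1) * Real.exp (-(Q z))
      = (∫ z in Set.Ioc (0 : ℝ) y, m1 z * (φ z / γ z) * Real.exp (-(Q z)))
        - ∫ z in Set.Ioc (0 : ℝ) y, Real.exp (-(Q z)) := by
    rw [← integral_sub hd hw]
    refine integral_congr_ae (Filter.Eventually.of_forall fun z => ?_)
    simp only
    ring
  rw [hR]
  have he : Real.exp (Q y) * Real.exp (-Q y) = 1 := by
    rw [← Real.exp_add]; simp
  linear_combination Real.exp (Q y) * hsum + y * he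
end

section
/- Let γ: (0,∞)→(0,∞) be continuous, φ: (0,∞)→[0,∞) measurable with φ/γ locally integrable on (0,∞), let Q(x) = ∫_x^{x̄} φ(y)/γ(y) dy be finite on (0,∞), and suppose ∫₀^δ φ(x)/γ(x) dx = +∞ for some δ>0. Let ν: (0,∞)→(0,∞) be a positive, decreasing, locally absolutely continuous function with ν(y)→0 as y→∞, with derivative ν' (defined a.e., ν' ≤ 0), and define h(x,y) = −ν'(x+y)/ν(y). Then ∫₀^∞ h(x,y)dx = 1 for every y>0, and the function v*(x) = −ν'(x) e^{−Q(x)} satisfies Kv* = v* almost everywhere on (0,∞), where Kv(x) = ∫₀^x h(x−z,z)(φ(z)/γ(z)) e^{−Q(z)} (∫_z^∞ v(y) e^{Q(y)} dy) dz. -/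
open MeasureTheory Filter

lemma exp_comp_ac {f : ℝ → ℝ} {a b : ℝ} (hf : AbsolutelyContinuousOnInterval f a b) :
    AbsolutelyContinuousOnInterval (fun x => Real.exp (f x)) a b := by
  obtain ⟨M, hM⟩ := hf.exists_bound
  rw [absolutelyContinuousOnInterval_iff] at hf ⊢
  have key : ∀ x ∈ Set.uIcc a b, ∀ y ∈ Set.uIcc a b,
      dist (Real.exp (f x)) (Real.exp (f y)) ≤ Real.exp M * dist (f x) (f y) := by
    have : ∀ u v : ℝ, u ≤ M → Real.exp u - Real.exp v ≤ Real.exp M * |u - v| := by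
      intro u v hu
      have h1 : Real.exp u - Real.exp v ≤ Real.exp u * (u - v) := by
        have := Real.add_one_le_exp (v - u)
        have h2 : Real.exp v = Real.exp u * Real.exp (v - u) := by
          rw [← Real.exp_add]; congr 1; ring
        rw [h2]
        nlinarith [Real.exp_pos u]
      calc _ ≤ _ := h1
        _ ≤ Real.exp u * |u - v| := by gcongr; exact le_abs_self _
        _ ≤ _ := by gcongr
    intro x hx y hy
    have h1 := this (f x) (f y) ((le_abs_self _).trans (hM x hx))
    have h2 := this (f y) (f x) ((le_abs_self _).trans (hM y hy))
    rw [abs_sub_comm] at h2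
    rw [Real.dist_eq, Real.dist_eq, abs_le]
    constructor <;> linarith
  intro ε hε
  obtain ⟨δ, hδ, h⟩ := hf (ε / Real.exp M) (by positivity)
  refine ⟨δ, hδ, fun E hE hE2 => ?_⟩
  have := h E hE hE2
  rw [lt_div_iff₀' (Real.exp_pos M), Finset.mul_sum] at this
  refine lt_of_le_of_lt (Finset.sum_le_sum fun i hi => ?_) this
  exact key _ (hE.1 i hi).1 _ (hE.1 i hi).2

lemma int_exp {g : ℝ → ℝ} {a b : ℝ} (hg : IntervalIntegrable g volume a b) :
    IntervalIntegrable (fun x => g x * Real.exp (∫ t in a..x, g t)) volume a b ∧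
    ∫ x in a..b, g x * Real.exp (∫ t in a..x, g t) = Real.exp (∫ t in a..b, g t) - 1 := by
  have hac := hg.absolutelyContinuousOnInterval_intervalIntegral (c := a) (by simp)
  have hac2 := exp_comp_ac hac
  refine ⟨hg.mul_continuousOn hac2.continuousOn, ?_⟩
  have := hac2.integral_deriv_eq_sub
  simp only [intervalIntegral.integral_same, Real.exp_zero] at this
  rw [← this]
  apply intervalIntegral.integral_congr_ae
  filter_upwards [hg.ae_hasDerivAt_integral] with x hx hx2
  have := (hx (Set.uIoc_subset_uIcc hx2) a (by simp)).exp.deriv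
  rw [this, mul_comm]

lemma tail_int {ν w : ℝ → ℝ} (hνlim : Tendsto ν atTop (nhds 0))
    (hw : ∀ x, 0 < x → w x ≤ 0)
    (hwint : ∀ a c : ℝ, 0 < a → a ≤ c → IntervalIntegrable w volume a c)
    (hνAC : ∀ a c : ℝ, 0 < a → a ≤ c → ν c - ν a = ∫ y in a..c, w y) (z : ℝ) (hz : 0 < z) :
    ∫ y in Set.Ioi z, -(w y) = ν z := by
  have hb : Tendsto (fun n : ℕ => z + (n : ℝ)) atTop atTop :=
    tendsto_atTop_add_const_left _ _ tendsto_natCast_atTop_atTop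
  have hc := aecover_Iic (μ := volume.restrict (Set.Ioi z)) hb
  have hr : ∀ n : ℕ, (volume.restrict (Set.Ioi z)).restrict (Set.Iic (z + (n : ℝ)))
      = volume.restrict (Set.Ioc z (z + n)) := by
    intro n
    rw [Measure.restrict_restrict measurableSet_Iic, Set.inter_comm, Set.Ioi_inter_Iic]
  refine hc.integral_eq_of_tendsto_of_nonneg_ae _ ?_ ?_ ?_
  · filter_upwards [ae_restrict_mem measurableSet_Ioi] with y hy
    have := hw y (hz.trans hy)
    simpa using this
  · intro n
    have h := (hwint z (z + n) hz (by simp)).neg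
    rw [intervalIntegrable_iff_integrableOn_Ioc_of_le (by simp)] at h
    rw [IntegrableOn, hr]; exact h
  · have : ∀ n : ℕ, ∫ x in Set.Iic (z + (n : ℝ)), -(w x) ∂(volume.restrict (Set.Ioi z))
        = ν z - ν (z + n) := by
      intro n
      rw [hr, ← intervalIntegral.integral_of_le (by simp), intervalIntegral.integral_neg,
        ← hνAC z _ hz (by simp)]; ring
    simp only [this]
    simpa using (hνlim.comp hb).const_sub (ν z)

lemma Q_tend {g : ℝ → ℝ} (hg0 : ∀ x, 0 < x → 0 ≤ g x)
    (hloc : LocallyIntegrableOn g (Set.Ioi 0)) 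
    (hint : ∀ a c, 0 < a → 0 < c → IntervalIntegrable g volume a c)
    (hdiv : ∃ δ : ℝ, 0 < δ ∧ (∫⁻ x in Set.Ioc (0 : ℝ) δ, ENNReal.ofReal (g x)) = ⊤)
    (x : ℝ) (hx : 0 < x) (a : ℕ → ℝ) (ha : ∀ n, 0 < a n) (hax : ∀ n, a n ≤ x)
    (hlim : Tendsto a atTop (nhds 0)) :
    Tendsto (fun n => ∫ t in (a n)..x, g t) atTop atTop := by
  obtain ⟨δ, hδ, hd⟩ := hdiv
  have hval : ∀ b c, 0 < b → b ≤ c → ∫⁻ t in Set.Ioc b c, ENNReal.ofReal (g t) =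
      ENNReal.ofReal (∫ t in b..c, g t) := by
    intro b c hb hbc
    rw [intervalIntegral.integral_of_le hbc, ofReal_integral_eq_lintegral_ofReal]
    · have := hint b c hb (hb.trans_le hbc)
      rwa [intervalIntegrable_iff_integrableOn_Ioc_of_le hbc] at this
    · filter_upwards [ae_restrict_mem measurableSet_Ioc] with y hy
      exact hg0 y (hb.trans hy.1)
  have htop : ∫⁻ t in Set.Ioc 0 x, ENNReal.ofReal (g t) = ⊤ := by
    rcases le_total δ x with h | h
    · rw [eq_top_iff, ← hd]
      exact lintegral_mono_set (Set.Ioc_subset_Ioc_right h)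
    · by_contra hne
      rw [← Set.Ioc_union_Ioc_eq_Ioc hx.le h, lintegral_union measurableSet_Ioc
        (Set.Ioc_disjoint_Ioc_of_le le_rfl), hval x δ hx h] at hd
      exact (ENNReal.add_ne_top.2 ⟨hne, ENNReal.ofReal_ne_top⟩) hd
  have hm : AEMeasurable (fun t => ENNReal.ofReal (g t)) (volume.restrict (Set.Ioc 0 x)) :=
    ((hloc.aestronglyMeasurable.mono_measure
      (Measure.restrict_mono Set.Ioc_subset_Ioi_self le_rfl)).aemeasurable).ennreal_ofReal
  have hc := aecover_Ioc_of_Ioc (μ := volume) hlim (tendsto_const_nhds (x := x) (f := atTop))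
  have h := hc.lintegral_tendsto_of_countably_generated hm
  rw [htop] at h
  have he : ∀ n, ∫⁻ t in Set.Ioc (a n) x, ENNReal.ofReal (g t) ∂(volume.restrict (Set.Ioc 0 x))
      = ENNReal.ofReal (∫ t in (a n)..x, g t) := by
    intro n
    rw [Measure.restrict_restrict measurableSet_Ioc, Set.inter_eq_left.2
      (Set.Ioc_subset_Ioc_left (ha n).le), hval _ _ (ha n) (hax n)]
  simp only [he] at h
  exact ENNReal.tendsto_ofReal_nhds_top.1 h

lemma main_int {g Q : ℝ → ℝ} {xbar : ℝ} (hxbar : 0 < xbar) (hg0 : ∀ x, 0 < x → 0 ≤ g x)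
    (hloc : LocallyIntegrableOn g (Set.Ioi 0)) 
    (hQint : ∀ x, 0 < x → IntervalIntegrable g volume x xbar)
    (hQ : ∀ x, 0 < x → Q x = ∫ y in x..xbar, g y)
    (hdiv : ∃ δ : ℝ, 0 < δ ∧ (∫⁻ x in Set.Ioc (0 : ℝ) δ, ENNReal.ofReal (g x)) = ⊤)
    (x : ℝ) (hx : 0 < x) :
    ∫ z in Set.Ioc 0 x, g z * Real.exp (-(Q z)) = Real.exp (-(Q x)) := by
  have hint : ∀ a c, 0 < a → 0 < c → IntervalIntegrable g volume a c := fun a c h1 h2 =>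
    (hQint a h1).trans (hQint c h2).symm
  have hdiff : ∀ a c, 0 < a → 0 < c → -(Q c) = -(Q a) + ∫ t in a..c, g t := by
    intro a c h1 h2
    rw [hQ a h1, hQ c h2, ← intervalIntegral.integral_add_adjacent_intervals
      (hint a c h1 h2) (hQint c h2)]
    ring
  have hpart : ∀ a, 0 < a → a ≤ x → IntegrableOn (fun z => g z * Real.exp (-(Q z))) (Set.Ioc a x) ∧
      ∫ z in Set.Ioc a x, g z * Real.exp (-(Q z)) = Real.exp (-(Q x)) - Real.exp (-(Q a)) := by
    intro a ha hax
    obtain ⟨h1, h2⟩ := int_exp (hint a x ha hx)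
    have heq : Set.EqOn (fun z => Real.exp (-(Q a)) * (g z * Real.exp (∫ t in a..z, g t)))
        (fun z => g z * Real.exp (-(Q z))) (Set.Ioc a x) := by
      intro z hz
      simp only
      rw [hdiff a z ha (ha.trans hz.1), Real.exp_add]; ring
    rw [intervalIntegrable_iff_integrableOn_Ioc_of_le hax] at h1
    refine ⟨IntegrableOn.congr_fun (h1.const_mul (Real.exp (-(Q a)))) heq measurableSet_Ioc, ?_⟩
    rw [← setIntegral_congr_fun measurableSet_Ioc heq, integral_const_mul,
      ← intervalIntegral.integral_of_le hax, h2, hdiff a x ha hx, Real.exp_add]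
    ring
  let a : ℕ → ℝ := fun n => x / ((n : ℝ) + 1)
  have ha : ∀ n, 0 < a n := fun n => by positivity
  have hax : ∀ n, a n ≤ x := fun n => div_le_self hx.le (by simp)
  have hlim : Tendsto a atTop (nhds 0) :=
    tendsto_const_nhds.div_atTop (tendsto_atTop_add_const_right _ _ tendsto_natCast_atTop_atTop)
  have hq := Q_tend hg0 hloc hint hdiv x hx a ha hax hlim
  have hc := aecover_Ioc_of_Ioc (μ := volume) hlim (tendsto_const_nhds (x := x) (f := atTop))
  have hr : ∀ n, (volume.restrict (Set.Ioc 0 x)).restrict (Set.Ioc (a n) x)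
      = volume.restrict (Set.Ioc (a n) x) := fun n => by
    rw [Measure.restrict_restrict measurableSet_Ioc, Set.inter_eq_left.2
      (Set.Ioc_subset_Ioc_left (ha n).le)]
  refine hc.integral_eq_of_tendsto_of_nonneg_ae _ ?_ ?_ ?_
  · filter_upwards [ae_restrict_mem measurableSet_Ioc] with y hy
    exact mul_nonneg (hg0 y hy.1) (Real.exp_pos _).le
  · intro n
    rw [IntegrableOn, hr]; exact (hpart _ (ha n) (hax n)).1
  · simp only [hr, (hpart _ (ha _) (hax _)).2]
    have h1 : ∀ n, -(Q (a n)) = -(Q x) - ∫ t in (a n)..x, g t := fun n => by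
      rw [hdiff (a n) x (ha n) hx]; ring
    simp only [h1]
    have h2 : Tendsto (fun n => -(Q x) - ∫ t in (a n)..x, g t) atTop atBot := by
      simp only [sub_eq_add_neg]
      exact tendsto_atBot_add_const_left _ _ (tendsto_neg_atTop_atBot.comp hq)
    simpa using (Real.tendsto_exp_atBot.comp h2).const_sub (Real.exp (-(Q x)))

theorem stmt19 (γ φ Q : ℝ → ℝ) (xbar : ℝ) (ν w : ℝ → ℝ)
    (hγc : ContinuousOn γ (Set.Ioi 0)) (hγpos : ∀ x, 0 < x → 0 < γ x)
    (hφm : Measurable φ) (hφ : ∀ x, 0 < x → 0 ≤ φ x)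
    (hloc : LocallyIntegrableOn (fun y => φ y / γ y) (Set.Ioi 0))
    (hxbar : 0 < xbar)
    (hQint : ∀ x, 0 < x → IntervalIntegrable (fun y => φ y / γ y) volume x xbar)
    (hQ : ∀ x, 0 < x → Q x = ∫ y in x..xbar, φ y / γ y)
    (hdiv : ∃ δ : ℝ, 0 < δ ∧
      (∫⁻ x in Set.Ioc (0 : ℝ) δ, ENNReal.ofReal (φ x / γ x)) = ⊤)
    (hνpos : ∀ x, 0 < x → 0 < ν x)
    (hνanti : AntitoneOn ν (Set.Ioi 0))
    (hνlim : Tendsto ν atTop (nhds 0))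
    (hwm : Measurable w) (hw : ∀ x, 0 < x → w x ≤ 0)
    (hwint : ∀ a c : ℝ, 0 < a → a ≤ c → IntervalIntegrable w volume a c)
    (hνAC : ∀ a c : ℝ, 0 < a → a ≤ c → ν c - ν a = ∫ y in a..c, w y) :
    (∀ y, 0 < y → (∫ x in Set.Ioi (0 : ℝ), -(w (x + y)) / ν y) = 1) ∧
    ∀ᵐ x ∂(volume.restrict (Set.Ioi (0 : ℝ))),
      (∫ z in Set.Ioc (0 : ℝ) x,
          (-(w ((x - z) + z)) / ν z) * (φ z / γ z) * Real.exp (-(Q z))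
            * ∫ y in Set.Ioi z, (-(w y) * Real.exp (-(Q y))) * Real.exp (Q y))
        = -(w x) * Real.exp (-(Q x)) := by
  have hT := tail_int hνlim hw hwint hνAC
  refine ⟨fun y hy => ?_, ?_⟩
  · have h1 := (measurePreserving_add_right (volume : Measure ℝ) y).setIntegral_preimage_emb
      (measurableEmbedding_addRight y) (fun x => -(w x)) (Set.Ioi y)
    have h2 : (fun x => x + y) ⁻¹' (Set.Ioi y) = Set.Ioi (0 : ℝ) := by
      ext t; simp
    rw [h2, hT y hy] at h1
    rw [integral_div, h1, div_self (hνpos y hy).ne']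
  · filter_upwards [ae_restrict_mem measurableSet_Ioi] with x hx
    have hM := main_int hxbar (fun t ht => div_nonneg (hφ t ht) (hγpos t ht).le)
      hloc hQint hQ hdiv x hx
    rw [← hM, ← integral_const_mul]
    refine setIntegral_congr_fun measurableSet_Ioc fun z hz => ?_
    have hz0 : 0 < z := hz.1
    have h3 : ∀ y, (-(w y) * Real.exp (-(Q y))) * Real.exp (Q y) = -(w y) := fun y => by
      rw [mul_assoc, ← Real.exp_add]; simp
    simp only [h3, hT z hz0, sub_add_cancel]
    have := (hνpos z hz0).ne'
    field_simp
end
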